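/- Supremum bound for the remainder η (from the proof of Theorem 1.2): In the setting of the key estimate (3.9) — Ω an open ball in ℝ^n, R₀, R > 0, δ ∈ (0,1], u₀ ∈ C^{r+α}(closure(Ω),ℝ^l), Z ⊂ ℝ^N a compact convex set containing the closed R₀-neighborhood of the range of j_r u₀, F : closure(Ω) × [0,1] × Z → ℝ^l twice continuously differentiable, Y the set of u ∈ C^{r+α,1+α/r}(closure(Ω)×[0,δ],ℝ^l) with u(·,0) = u₀ and ‖u − u₀‖_{C^{r+α,1+α/r}} ≤ R, with j_r u(x,t) ∈ Z for every u ∈ Y, and for u, v ∈ Y, η(x,t) = F(x,t,j_r u(x,t)) − F(x,t,j_r v(x,t)) − Σ_{|I|≤r} Σ_b (∂F/∂z^b_I)(x,0,j_r u₀(x)) ∂_I (u−v)^b(x,t) — there exists a constant C(R), not depending on δ, u or v, such that the supremum norm satisfies |η|_{0;closure(Ω)×[0,δ]} ≤ C(R) δ^{2α/r} ‖u − v‖_{C^{r+α,1+α/r}(closure(Ω)×[0,δ])}. -/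

import Mathlib

open scoped BigOperators
noncomputable section

/-- Euclidean space `ℝ^n`. -/
abbrev Vec (n : ℕ) := EuclideanSpace ℝ (Fin n)

/-- Iterated spatial partial derivative (within `D`) in the directions `I = (i_1, …, i_k)`. -/
def pderivW {n l : ℕ} (D : Set (Vec n)) (k : ℕ) (I : Fin k → Fin n)
    (w : Vec n → Vec l) : Vec n → Vec l :=
  fun x => iteratedFDerivWithin ℝ k w D x (fun j => EuclideanSpace.single (I j) 1)

/-- Spatial partial derivative `∂_I u(⋅,t)` of a space-time function (within `D`). -/
def spDerivW {n l : ℕ} (D : Set (Vec n)) (k : ℕ) (I : Fin k → Fin n)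
    (u : Vec n → ℝ → Vec l) : Vec n → ℝ → Vec l :=
  fun x t => pderivW D k I (fun y => u y t) x

/-- Time derivative `∂_t u` within the time interval `J`. -/
def tDerivW {n l : ℕ} (J : Set ℝ) (u : Vec n → ℝ → Vec l) : Vec n → ℝ → Vec l :=
  fun x t => derivWithin (fun s => u x s) J t

/-- Supremum norm `|w|_{0;Q}`. -/
def supQ {n l : ℕ} (Q : Set (Vec n × ℝ)) (w : Vec n → ℝ → Vec l) : ℝ :=
  sSup {c | ∃ p ∈ Q, c = ‖w p.1 p.2‖}

/-- The set of parabolic Hölder difference quotients of exponent `α` (parabolic order `r`). -/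
def holQuot {n l : ℕ} (r : ℕ) (α : ℝ) (Q : Set (Vec n × ℝ))
    (w : Vec n → ℝ → Vec l) : Set ℝ :=
  {c | ∃ p ∈ Q, ∃ q ∈ Q, p ≠ q ∧
    c = ‖w p.1 p.2 - w q.1 q.2‖ / (‖p.1 - q.1‖ ^ α + |p.2 - q.2| ^ (α / r))}

/-- Parabolic Hölder seminorm `[w]_{α;Q}`. -/
def parSemi {n l : ℕ} (r : ℕ) (α : ℝ) (Q : Set (Vec n × ℝ))
    (w : Vec n → ℝ → Vec l) : ℝ :=
  sSup (holQuot r α Q w)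

/-- Parabolic Hölder norm `‖u‖_{C^{r+α,1+α/r}(D × J)}`. -/
def parNorm {n l : ℕ} (r : ℕ) (α : ℝ) (D : Set (Vec n)) (J : Set ℝ)
    (u : Vec n → ℝ → Vec l) : ℝ :=
  (∑ k ∈ Finset.range (r + 1), ∑ I : Fin k → Fin n, supQ (D ×ˢ J) (spDerivW D k I u))
    + supQ (D ×ˢ J) (tDerivW J u)
    + (∑ I : Fin r → Fin n, parSemi r α (D ×ˢ J) (spDerivW D r I u))
    + parSemi r α (D ×ˢ J) (tDerivW J u)

/-- Membership in the parabolic Hölder space `C^{r+α,1+α/r}(D × J, ℝ^l)`. -/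
def MemPar {n l : ℕ} (r : ℕ) (α : ℝ) (D : Set (Vec n)) (J : Set ℝ)
    (u : Vec n → ℝ → Vec l) : Prop :=
  ContinuousOn (fun p : Vec n × ℝ => u p.1 p.2) (D ×ˢ J) ∧
  (∀ t ∈ J, ContDiffOn ℝ r (fun x => u x t) D) ∧
  (∀ x ∈ D, DifferentiableOn ℝ (fun s => u x s) J) ∧
  (∀ k, k ≤ r → ∀ I : Fin k → Fin n,
    ContinuousOn (fun p : Vec n × ℝ => spDerivW D k I u p.1 p.2) (D ×ˢ J)) ∧
  ContinuousOn (fun p : Vec n × ℝ => tDerivW J u p.1 p.2) (D ×ˢ J) ∧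
  (∀ I : Fin r → Fin n, BddAbove (holQuot r α (D ×ˢ J) (spDerivW D r I u))) ∧
  BddAbove (holQuot r α (D ×ˢ J) (tDerivW J u))

/-- The norm of `C^{α,α/r}(Q)`. -/
def lowNorm {n l : ℕ} (r : ℕ) (α : ℝ) (Q : Set (Vec n × ℝ))
    (f : Vec n → ℝ → Vec l) : ℝ :=
  supQ Q f + parSemi r α Q f

/-- Membership in `C^{α,α/r}(Q, ℝ^l)`. -/
def MemLow {n l : ℕ} (r : ℕ) (α : ℝ) (Q : Set (Vec n × ℝ))
    (f : Vec n → ℝ → Vec l) : Prop :=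
  ContinuousOn (fun p : Vec n × ℝ => f p.1 p.2) Q ∧ BddAbove (holQuot r α Q f)

/-- Spatial Hölder quotient set. -/
def spHolQuot {n l : ℕ} (D : Set (Vec n)) (α : ℝ) (w : Vec n → Vec l) : Set ℝ :=
  {c | ∃ x ∈ D, ∃ y ∈ D, x ≠ y ∧ c = ‖w x - w y‖ / ‖x - y‖ ^ α}

/-- The elliptic Hölder norm `‖u₀‖_{C^{r+α}(D)}`. -/
def spNorm {n l : ℕ} (r : ℕ) (α : ℝ) (D : Set (Vec n)) (u₀ : Vec n → Vec l) : ℝ :=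
  (∑ k ∈ Finset.range (r + 1), ∑ I : Fin k → Fin n,
    sSup {c | ∃ x ∈ D, c = ‖pderivW D k I u₀ x‖})
    + ∑ I : Fin r → Fin n, sSup (spHolQuot D α (pderivW D r I u₀))

/-- Membership in `C^{r+α}(D, ℝ^l)`. -/
def MemSp {n l : ℕ} (r : ℕ) (α : ℝ) (D : Set (Vec n)) (u₀ : Vec n → Vec l) : Prop :=
  ContDiffOn ℝ r u₀ D ∧ ∀ I : Fin r → Fin n, BddAbove (spHolQuot D α (pderivW D r I u₀))

/-- Action `(L_t u)(x)` of the time-dependent linear differential operator of order `r` with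
coefficients `A k I a b` (`k = |I| ≤ r`). -/
def applyL {n l : ℕ} (r : ℕ) (D : Set (Vec n))
    (A : (k : ℕ) → (Fin k → Fin n) → Fin l → Fin l → Vec n → ℝ → ℝ)
    (u : Vec n → ℝ → Vec l) : Vec n → ℝ → Vec l :=
  fun x t => (EuclideanSpace.equiv (Fin l) ℝ).symm fun a =>
    ∑ k ∈ Finset.range (r + 1), ∑ I : Fin k → Fin n, ∑ b : Fin l,
      A k I a b x t * spDerivW D k I u x t b

/-- Legendre–Hadamard strong ellipticity with constant `lam` on `Q`. -/
def StrongEllip {n l : ℕ} (r : ℕ)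
    (A : (k : ℕ) → (Fin k → Fin n) → Fin l → Fin l → Vec n → ℝ → ℝ)
    (Q : Set (Vec n × ℝ)) (lam : ℝ) : Prop :=
  ∀ p ∈ Q, ∀ ξ : Vec n, ∀ v : Vec l,
    lam * ‖ξ‖ ^ r * ‖v‖ ^ 2 ≤
      (-1 : ℝ) ^ (r / 2 - 1) *
        ∑ I : Fin r → Fin n, ∑ a : Fin l, ∑ b : Fin l,
          A r I a b p.1 p.2 * (∏ j, ξ (I j)) * v a * v b

/-- `ℤ^n`-periodicity. -/
def PerZ {n : ℕ} {β : Type*} (g : Vec n → β) : Prop :=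
  ∀ x : Vec n, ∀ m : Fin n → ℤ,
    g (x + (EuclideanSpace.equiv (Fin n) ℝ).symm fun i => (m i : ℝ)) = g x

/-- Real-valued functions viewed as `ℝ^1`-valued. -/
def toV1 {n : ℕ} (g : Vec n → ℝ → ℝ) : Vec n → ℝ → Vec 1 :=
  fun x t => (EuclideanSpace.equiv (Fin 1) ℝ).symm fun _ => g x t

/-- The `r`-jet space: components indexed by the derivative order `k ≤ r`,
a tuple of `k` spatial directions, and the component index `b`. -/
abbrev Jet (n l r : ℕ) := (k : Fin (r + 1)) → ((Fin (k : ℕ) → Fin n) → Fin l → ℝ)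

/-- The `r`-jet `j_r w(x) = (w(x), Dw(x), …, D^r w(x))` (derivatives within `D`). -/
def jetOf {n l : ℕ} (D : Set (Vec n)) (r : ℕ) (w : Vec n → Vec l) (x : Vec n) :
    Jet n l r :=
  fun k I b => pderivW D (k : ℕ) I w x b

/-- The basis jet vector corresponding to the jet component `(k, I, b)`;
differentiating in this direction gives `∂F/∂z^b_I`. -/
def jetBasisG {n l : ℕ} (r k : ℕ) (I : Fin k → Fin n) (b : Fin l) : Jet n l r :=
  fun k' I' b' => if h : (k' : ℕ) = k then
    (if (I' ∘ Fin.cast h.symm) = I ∧ b' = b then (1 : ℝ) else 0) else 0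

theorem exists_le_add_mul_succ_of_interp {a b : ℝ} (ha : 0 < a) (hb : 0 < b) (r k : ℕ) :
    ∀ ε : ℝ, 0 < ε → ∃ K : ℝ, 0 ≤ K ∧ ∀ M : ℕ → ℝ, (∀ j, 0 ≤ M j) →
      (∀ j, j + 2 ≤ r → ∀ s : ℝ, 0 < s → s ≤ 1 →
        M (j + 1) ≤ a / s * M j + b * s * M (j + 2)) →
      k + 1 ≤ r → M k ≤ K * M 0 + ε * M (k + 1) := by
  induction k with
  | zero =>
    intro ε hε
    refine ⟨1, zero_le_one, fun M hM _ _ => ?_⟩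
    have := mul_nonneg hε.le (hM (0 + 1))
    linarith
  | succ k ih =>
    intro ε hε
    obtain ⟨s, hs0, hs1, hsε⟩ : ∃ s : ℝ, 0 < s ∧ s ≤ 1 ∧ 2 * b * s ≤ ε := by
      refine ⟨min 1 (ε / (2 * b)), by positivity, min_le_left _ _, ?_⟩
      calc 2 * b * min 1 (ε / (2 * b)) ≤ 2 * b * (ε / (2 * b)) := by
            gcongr
            exact min_le_right _ _
        _ = ε := by field_simp
    obtain ⟨K, hK0, hK⟩ := ih (s / (2 * a)) (by positivity)
    refine ⟨2 * (a / s) * K, by positivity, fun M hM hstep hk => ?_⟩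
    have h1 := hK M hM hstep (by omega)
    have h2 := hstep k (by omega) s hs0 hs1
    have h3 : a / s * M k ≤ a / s * (K * M 0 + s / (2 * a) * M (k + 1)) := by gcongr
    have h4 : a / s * (s / (2 * a) * M (k + 1)) = M (k + 1) / 2 := by field_simp
    have h5 := mul_le_mul_of_nonneg_right hsε (hM (k + 2))
    show M (k + 1) ≤ 2 * (a / s) * K * M 0 + ε * M (k + 2)
    linarith

theorem exists_le_mul_add_of_interp {a b : ℝ} (ha : 0 < a) (hb : 0 < b) (r : ℕ) :
    ∃ K : ℝ, 0 ≤ K ∧ ∀ M : ℕ → ℝ, (∀ j, 0 ≤ M j) →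
      (∀ j, j + 2 ≤ r → ∀ s : ℝ, 0 < s → s ≤ 1 →
        M (j + 1) ≤ a / s * M j + b * s * M (j + 2)) →
      ∀ k ≤ r, M k ≤ K * (M 0 + M r) := by
  have key : ∀ d : ℕ, ∃ K : ℝ, 0 ≤ K ∧ ∀ M : ℕ → ℝ, (∀ j, 0 ≤ M j) →
      (∀ j, j + 2 ≤ r → ∀ s : ℝ, 0 < s → s ≤ 1 →
        M (j + 1) ≤ a / s * M j + b * s * M (j + 2)) →
      ∀ k, k + d = r → M k ≤ K * (M 0 + M r) := by
    intro d
    induction d with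
    | zero =>
      refine ⟨1, zero_le_one, fun M hM _ k hk => ?_⟩
      obtain rfl : k = r := by omega
      linarith [hM 0]
    | succ d ih =>
      obtain ⟨K, hK0, hK⟩ := ih
      obtain ⟨K', hK'0, hK'⟩ :=
        exists_le_add_mul_succ_of_interp ha hb r (r - (d + 1)) 1 one_pos
      refine ⟨K' + K, by positivity, fun M hM hstep k hk => ?_⟩
      obtain rfl : k = r - (d + 1) := by omega
      have h1 := hK' M hM hstep (by omega)
      have h2 := hK M hM hstep (r - (d + 1) + 1) (by omega)
      have h3 := mul_nonneg hK'0 (hM r)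
      linarith
  choose K hK0 hK using key
  refine ⟨∑ d ∈ Finset.range (r + 1), K d, Finset.sum_nonneg fun d _ => hK0 d,
    fun M hM hstep k hk => (hK (r - k) M hM hstep k (by omega)).trans ?_⟩
  have := hM 0
  have := hM r
  gcongr
  exact Finset.single_le_sum (f := K) (fun d _ => hK0 d) (Finset.mem_range.2 (by omega))

section Interpolation

variable {E G : Type*} [NormedAddCommGroup E] [NormedSpace ℝ E]
  [NormedAddCommGroup G] [NormedSpace ℝ G]

theorem uniqueDiffOn_closedBall (x₀ : E) {ρ : ℝ} (hρ : 0 < ρ) :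
    UniqueDiffOn ℝ (Metric.closedBall x₀ ρ) :=
  uniqueDiffOn_convex (convex_closedBall x₀ ρ)
    ⟨x₀, Metric.ball_subset_interior_closedBall (Metric.mem_ball_self hρ)⟩

/-- A vector-valued Landau inequality on a ball. -/
theorem norm_fderivWithin_closedBall_le {x₀ : E} {ρ : ℝ} (hρ : 0 < ρ) {g : E → G}
    (hg : DifferentiableOn ℝ g (Metric.closedBall x₀ ρ)) {m L : ℝ} (hL : 0 ≤ L)
    (hm : ∀ x ∈ Metric.closedBall x₀ ρ, ‖g x‖ ≤ m)
    (hLip : ∀ x ∈ Metric.closedBall x₀ ρ, ∀ y ∈ Metric.closedBall x₀ ρ,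
      ‖fderivWithin ℝ g (Metric.closedBall x₀ ρ) y -
        fderivWithin ℝ g (Metric.closedBall x₀ ρ) x‖ ≤ L * ‖y - x‖)
    {s : ℝ} (hs0 : 0 < s) (hs1 : s ≤ 1) {x : E} (hx : x ∈ Metric.closedBall x₀ ρ) :
    ‖fderivWithin ℝ g (Metric.closedBall x₀ ρ) x‖ ≤ 4 / ρ / s * m + 8 * ρ * s * L := by
  set D := Metric.closedBall x₀ ρ with hD
  set T := fderivWithin ℝ g D x with hT
  have hm0 : 0 ≤ m := (norm_nonneg _).trans (hm x hx)
  have hDc : Convex ℝ D := convex_closedBall x₀ ρ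
  have dir : ∀ h : E, x + h ∈ D → ‖T h‖ ≤ 2 / s * m + 4 * ρ ^ 2 * s * L := by
    intro h hxh
    have hh : ‖h‖ ≤ 2 * ρ := by
      have h1 : dist (x + h) x ≤ ρ + ρ := (dist_triangle_right _ _ x₀).trans (add_le_add hxh hx)
      rw [dist_eq_norm, add_sub_cancel_left] at h1
      linarith
    have hxs : x + s • h ∈ D := hDc.add_smul_mem hx hxh ⟨hs0.le, hs1⟩
    have hns : ‖s • h‖ = s * ‖h‖ := by rw [norm_smul, Real.norm_of_nonneg hs0.le]
    have key : ‖g (x + s • h) - g x - T (x + s • h - x)‖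
        ≤ L * ‖s • h‖ * ‖x + s • h - x‖ := by
      refine (hDc.inter (convex_closedBall x ‖s • h‖)).norm_image_sub_le_of_norm_hasFDerivWithin_le'
        (f' := fderivWithin ℝ g D)
        (fun y hy => ((hg y hy.1).hasFDerivWithinAt).mono Set.inter_subset_left)
        (fun y hy => (hLip x hx y hy.1).trans ?_) ⟨hx, by simp⟩ ⟨hxs, by simp⟩
      have := hy.2
      rw [Metric.mem_closedBall, dist_eq_norm] at this
      gcongr
    rw [add_sub_cancel_left, map_smul, hns] at key
    have h2 : ‖s • T h‖ ≤ ‖g (x + s • h)‖ + ‖g x‖ + ‖g (x + s • h) - g x - s • T h‖ := by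
      have : s • T h = g (x + s • h) - g x - (g (x + s • h) - g x - s • T h) := by abel
      calc ‖s • T h‖ = ‖g (x + s • h) - g x - (g (x + s • h) - g x - s • T h)‖ := by rw [← this]
        _ ≤ ‖g (x + s • h) - g x‖ + ‖g (x + s • h) - g x - s • T h‖ := norm_sub_le _ _
        _ ≤ _ := by gcongr; exact norm_sub_le _ _
    rw [norm_smul, Real.norm_of_nonneg hs0.le] at h2
    have h3 : L * (s * ‖h‖) * (s * ‖h‖) ≤ L * (s * (2 * ρ)) * (s * (2 * ρ)) := by gcongr
    have h4 : s * ‖T h‖ ≤ s * (2 / s * m + 4 * ρ ^ 2 * s * L) := by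
      have : s * (2 / s * m + 4 * ρ ^ 2 * s * L) = 2 * m + L * (s * (2 * ρ)) * (s * (2 * ρ)) := by
        field_simp
        ring
      linarith [hm x hx, hm _ hxs]
    exact le_of_mul_le_mul_left h4 hs0
  refine ContinuousLinearMap.opNorm_le_of_unit_norm (by positivity) fun e he => ?_
  have h1 := dir (x₀ - x + ρ • e) (by
    simp [hD, norm_smul, he, abs_of_pos hρ, ← add_assoc])
  have h2 := dir (x₀ - x) (by simp [hD, hρ.le])
  have h3 : ρ * ‖T e‖ ≤ 2 * (2 / s * m + 4 * ρ ^ 2 * s * L) := by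
    calc ρ * ‖T e‖ = ‖T (x₀ - x + ρ • e) - T (x₀ - x)‖ := by
          rw [← map_sub, add_sub_cancel_left, map_smul, norm_smul, Real.norm_of_nonneg hρ.le]
      _ ≤ _ := (norm_sub_le _ _).trans (by linarith)
  refine le_of_mul_le_mul_left (h3.trans_eq ?_) hρ
  field_simp
  ring

/-- Intermediate derivatives on a closed ball are controlled by the function and its
derivative of top order. -/
theorem exists_norm_iteratedFDerivWithin_le [ProperSpace E] (x₀ : E) {ρ : ℝ} (hρ : 0 < ρ)
    (r : ℕ) :
    ∃ K : ℝ, 0 ≤ K ∧ ∀ f : E → G, ContDiffOn ℝ r f (Metric.closedBall x₀ ρ) → ∀ A B : ℝ,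
      (∀ x ∈ Metric.closedBall x₀ ρ, ‖f x‖ ≤ A) →
      (∀ x ∈ Metric.closedBall x₀ ρ,
        ‖iteratedFDerivWithin ℝ r f (Metric.closedBall x₀ ρ) x‖ ≤ B) →
      ∀ k ≤ r, ∀ x ∈ Metric.closedBall x₀ ρ,
        ‖iteratedFDerivWithin ℝ k f (Metric.closedBall x₀ ρ) x‖ ≤ K * (A + B) := by
  obtain ⟨K, hK0, hK⟩ := exists_le_mul_add_of_interp (a := 4 / ρ) (b := 8 * ρ)
    (by positivity) (by positivity) r
  refine ⟨K, hK0, fun f hf A B hA hB k hk x hx => ?_⟩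
  set D := Metric.closedBall x₀ ρ with hD
  have hDu : UniqueDiffOn ℝ D := uniqueDiffOn_closedBall x₀ hρ
  have hDne : D.Nonempty := ⟨x, hx⟩
  let M : ℕ → ℝ := fun j => sSup ((fun y => ‖iteratedFDerivWithin ℝ j f D y‖) '' D)
  have hle : ∀ j ≤ r, ∀ y ∈ D, ‖iteratedFDerivWithin ℝ j f D y‖ ≤ M j := fun j hj y hy =>
    le_csSup ((isCompact_closedBall x₀ ρ).bddAbove_image
      (hf.continuousOn_iteratedFDerivWithin (by exact_mod_cast hj) hDu).norm) ⟨y, hy, rfl⟩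
  have hM0 : ∀ j, 0 ≤ M j := fun j =>
    Real.sSup_nonneg (by rintro _ ⟨y, -, rfl⟩; exact norm_nonneg _)
  refine (hle k hk x hx).trans ((hK M hM0 ?_ k hk).trans ?_)
  · intro j hj s hs0 hs1
    refine csSup_le (hDne.image _) ?_
    rintro _ ⟨y, hy, rfl⟩
    dsimp only
    rw [← norm_fderivWithin_iteratedFDerivWithin]
    refine norm_fderivWithin_closedBall_le hρ
      (hf.differentiableOn_iteratedFDerivWithin (by exact_mod_cast (by omega : j < r)) hDu)
      (hM0 _) (hle j (by omega)) (fun z hz w hw => ?_) hs0 hs1 hy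
    have h1 := (convex_closedBall x₀ ρ).norm_image_sub_le_of_norm_fderivWithin_le
      (𝕜 := ℝ) (f := iteratedFDerivWithin ℝ (j + 1) f D) (C := M (j + 2))
      (hf.differentiableOn_iteratedFDerivWithin (by exact_mod_cast (by omega : j + 1 < r)) hDu)
      (fun y hy => by
        rw [norm_fderivWithin_iteratedFDerivWithin]
        exact hle (j + 2) hj y hy) hz hw
    rwa [iteratedFDerivWithin_succ_eq_comp_left, Function.comp_apply, Function.comp_apply,
      ← dist_eq_norm, LinearIsometryEquiv.dist_map, dist_eq_norm] at h1
  · have h0 : M 0 ≤ A := csSup_le (hDne.image _) (by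
      rintro _ ⟨y, hy, rfl⟩
      simpa using hA y hy)
    have h1 : M r ≤ B := csSup_le (hDne.image _) (by
      rintro _ ⟨y, hy, rfl⟩
      exact hB y hy)
    gcongr

end Interpolation

section ParabolicSpaces

variable {n l r : ℕ} {α : ℝ} {D : Set (Vec n)} {J : Set ℝ} {u v : Vec n → ℝ → Vec l}

theorem norm_le_sum_norm_apply_single {k : ℕ}
    (T : ContinuousMultilinearMap ℝ (fun _ : Fin k => Vec n) (Vec l)) :
    ‖T‖ ≤ ∑ I : Fin k → Fin n, ‖T fun j => EuclideanSpace.single (I j) 1‖ := by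
  refine ContinuousMultilinearMap.opNorm_le_bound (Finset.sum_nonneg fun _ _ => norm_nonneg _)
    fun m => ?_
  have hm : m = fun j => ∑ i : Fin n, m j i • (EuclideanSpace.single i (1 : ℝ) : Vec n) := by
    funext j
    ext i
    simp [Finset.sum_apply, Pi.single_apply]
  have hT : T m = ∑ I : Fin k → Fin n,
      (∏ j, m j (I j)) • T fun j => EuclideanSpace.single (I j) 1 := by
    conv_lhs => rw [hm]
    rw [ContinuousMultilinearMap.map_sum]
    exact Finset.sum_congr rfl fun I _ => T.map_smul_univ _ _
  rw [hT, Finset.sum_mul]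
  refine (norm_sum_le _ _).trans (Finset.sum_le_sum fun I _ => ?_)
  rw [norm_smul, norm_prod, mul_comm]
  gcongr with j
  exact PiLp.norm_apply_le (m j) (I j)

theorem norm_pderivW_le (k : ℕ) (I : Fin k → Fin n) (w : Vec n → Vec l) (x : Vec n) :
    ‖pderivW D k I w x‖ ≤ ‖iteratedFDerivWithin ℝ k w D x‖ := by
  refine (ContinuousMultilinearMap.le_opNorm _ _).trans_eq ?_
  simp

theorem norm_jetOf_le {w : Vec n → Vec l} {x : Vec n} {B : ℝ} (hB0 : 0 ≤ B)
    (hB : ∀ k ≤ r, ‖iteratedFDerivWithin ℝ k w D x‖ ≤ B) : ‖jetOf D r w x‖ ≤ B := by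
  refine (pi_norm_le_iff_of_nonneg hB0).2 fun k => (pi_norm_le_iff_of_nonneg hB0).2 fun I =>
    (pi_norm_le_iff_of_nonneg hB0).2 fun b => ?_
  exact (PiLp.norm_apply_le _ b).trans
    ((norm_pderivW_le _ I w x).trans (hB k (Nat.lt_succ_iff.1 k.2)))

theorem pderivW_sub (hD : UniqueDiffOn ℝ D) {f g : Vec n → Vec l} (hf : ContDiffOn ℝ r f D)
    (hg : ContDiffOn ℝ r g D) {k : ℕ} (hk : k ≤ r) (I : Fin k → Fin n) {x : Vec n} (hx : x ∈ D) :
    pderivW D k I (fun y => f y - g y) x = pderivW D k I f x - pderivW D k I g x := by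
  have hk' : (k : WithTop ℕ∞) ≤ r := by exact_mod_cast hk
  unfold pderivW
  rw [fun_iteratedFDerivWithin_sub_apply ((hf x hx).of_le hk') ((hg x hx).of_le hk') hD hx]
  rfl

theorem jetOf_sub (hD : UniqueDiffOn ℝ D) {f g : Vec n → Vec l} (hf : ContDiffOn ℝ r f D)
    (hg : ContDiffOn ℝ r g D) {x : Vec n} (hx : x ∈ D) :
    jetOf D r (fun y => f y - g y) x = jetOf D r f x - jetOf D r g x := by
  funext k I b
  simp only [jetOf, pderivW_sub hD hf hg (Nat.lt_succ_iff.1 k.2) I hx, Pi.sub_apply,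
    PiLp.sub_apply]

theorem sum_pderivW_smul_jetBasisG (w : Vec n → Vec l) (x : Vec n) :
    ∑ k ∈ Finset.range (r + 1), ∑ I : Fin k → Fin n, ∑ b : Fin l,
      pderivW D k I w x b • (jetBasisG r k I b : Jet n l r) = jetOf D r w x := by
  funext k' I' b'
  simp only [Finset.sum_apply, Pi.smul_apply, smul_eq_mul, jetOf]
  rw [Finset.sum_eq_single (k' : ℕ)]
  · rw [Finset.sum_eq_single I', Finset.sum_eq_single b']
    · simp [jetBasisG]
    · intro b _ hb
      simp [jetBasisG, hb.symm]
    · simp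
    · intro I _ hI
      refine Finset.sum_eq_zero fun b _ => ?_
      have : ¬ (I' ∘ Fin.cast rfl = I ∧ b' = b) := fun h => hI h.1.symm
      simp only [jetBasisG, dif_pos, if_neg this, mul_zero]
    · simp
  · intro k _ hk
    refine Finset.sum_eq_zero fun I _ => Finset.sum_eq_zero fun b _ => ?_
    simp [jetBasisG, hk.symm]
  · intro h
    exact absurd (Finset.mem_range.2 k'.2) h

theorem supQ_nonneg (Q : Set (Vec n × ℝ)) (w : Vec n → ℝ → Vec l) : 0 ≤ supQ Q w :=
  Real.sSup_nonneg (by rintro _ ⟨p, -, rfl⟩; exact norm_nonneg _)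

theorem nonneg_of_mem_holQuot {Q : Set (Vec n × ℝ)} {w : Vec n → ℝ → Vec l} {c : ℝ}
    (hc : c ∈ holQuot r α Q w) : 0 ≤ c := by
  obtain ⟨p, -, q, -, -, rfl⟩ := hc
  positivity

theorem parSemi_nonneg (Q : Set (Vec n × ℝ)) (w : Vec n → ℝ → Vec l) : 0 ≤ parSemi r α Q w :=
  Real.sSup_nonneg fun _ hc => nonneg_of_mem_holQuot hc

theorem sum_parSemi_le_parNorm :
    ∑ I : Fin r → Fin n, parSemi r α (D ×ˢ J) (spDerivW D r I u) ≤ parNorm r α D J u := by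
  have h1 : 0 ≤ ∑ k ∈ Finset.range (r + 1), ∑ I : Fin k → Fin n,
      supQ (D ×ˢ J) (spDerivW D k I u) :=
    Finset.sum_nonneg fun _ _ => Finset.sum_nonneg fun _ _ => supQ_nonneg _ _
  have h2 := supQ_nonneg (D ×ˢ J) (tDerivW J u)
  have h3 := parSemi_nonneg (r := r) (α := α) (D ×ˢ J) (tDerivW J u)
  unfold parNorm
  linarith

theorem supQ_tDerivW_le_parNorm : supQ (D ×ˢ J) (tDerivW J u) ≤ parNorm r α D J u := by
  have h1 : 0 ≤ ∑ k ∈ Finset.range (r + 1), ∑ I : Fin k → Fin n,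
      supQ (D ×ˢ J) (spDerivW D k I u) :=
    Finset.sum_nonneg fun _ _ => Finset.sum_nonneg fun _ _ => supQ_nonneg _ _
  have h2 : 0 ≤ ∑ I : Fin r → Fin n, parSemi r α (D ×ˢ J) (spDerivW D r I u) :=
    Finset.sum_nonneg fun _ _ => parSemi_nonneg _ _
  have h3 := parSemi_nonneg (r := r) (α := α) (D ×ˢ J) (tDerivW J u)
  unfold parNorm
  linarith

theorem parNorm_nonneg : 0 ≤ parNorm r α D J u :=
  (supQ_nonneg _ _).trans supQ_tDerivW_le_parNorm

theorem bddAbove_holQuot_of_eq_sub {Q : Set (Vec n × ℝ)} {w f g : Vec n → ℝ → Vec l}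
    (hf : BddAbove (holQuot r α Q f)) (hg : BddAbove (holQuot r α Q g))
    (h : ∀ p ∈ Q, w p.1 p.2 = f p.1 p.2 - g p.1 p.2) : BddAbove (holQuot r α Q w) := by
  obtain ⟨A, hA⟩ := hf
  obtain ⟨B, hB⟩ := hg
  refine ⟨A + B, ?_⟩
  rintro _ ⟨p, hp, q, hq, hpq, rfl⟩
  refine le_trans ?_ (add_le_add (hA ⟨p, hp, q, hq, hpq, rfl⟩) (hB ⟨p, hp, q, hq, hpq, rfl⟩))
  rw [← add_div, h p hp, h q hq]
  gcongr
  rw [sub_sub_sub_comm]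
  exact norm_sub_le _ _

theorem MemPar.sub (hD : UniqueDiffOn ℝ D) (hJ : UniqueDiffOn ℝ J) (hu : MemPar r α D J u)
    (hv : MemPar r α D J v) : MemPar r α D J (fun x t => u x t - v x t) := by
  obtain ⟨u1, u2, u3, u4, u5, u6, u7⟩ := hu
  obtain ⟨v1, v2, v3, v4, v5, v6, v7⟩ := hv
  have hsp : ∀ k, k ≤ r → ∀ I : Fin k → Fin n, ∀ p ∈ D ×ˢ J,
      spDerivW D k I (fun x t => u x t - v x t) p.1 p.2
        = spDerivW D k I u p.1 p.2 - spDerivW D k I v p.1 p.2 := fun k hk I p hp =>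
    pderivW_sub hD (u2 _ hp.2) (v2 _ hp.2) hk I hp.1
  have ht : ∀ p ∈ D ×ˢ J, tDerivW J (fun x t => u x t - v x t) p.1 p.2
      = tDerivW J u p.1 p.2 - tDerivW J v p.1 p.2 := fun p hp =>
    ((u3 _ hp.1 _ hp.2).hasDerivWithinAt.fun_sub
      (v3 _ hp.1 _ hp.2).hasDerivWithinAt).derivWithin (hJ _ hp.2)
  exact ⟨u1.sub v1, fun t htJ => (u2 t htJ).sub (v2 t htJ),
    fun x hx => (u3 x hx).fun_sub (v3 x hx),
    fun k hk I => ((u4 k hk I).sub (v4 k hk I)).congr (hsp k hk I), (u5.sub v5).congr ht,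
    fun I => bddAbove_holQuot_of_eq_sub (u6 I) (v6 I) (hsp r le_rfl I),
    bddAbove_holQuot_of_eq_sub u7 v7 ht⟩

theorem MemSp.memPar (hD : UniqueDiffOn ℝ D) {u₀ : Vec n → Vec l} (hu₀ : MemSp r α D u₀) :
    MemPar r α D J (fun x _ => u₀ x) := by
  obtain ⟨h1, h2⟩ := hu₀
  have ht : tDerivW J (fun x _ => u₀ x) = fun _ _ => (0 : Vec l) := by
    funext x t
    simp [tDerivW]
  refine ⟨h1.continuousOn.comp continuousOn_fst fun p hp => hp.1, fun _ _ => h1,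
    fun _ _ => differentiableOn_const _, fun k hk I => ?_, ?_, fun I => ?_, ?_⟩
  · have h3 : ContinuousOn (pderivW D k I u₀) D := fun x hx =>
      ((h1.continuousOn_iteratedFDerivWithin (by exact_mod_cast hk) hD) x hx).eval_const _
    exact h3.comp continuousOn_fst fun p hp => hp.1
  · rw [ht]
    exact continuousOn_const
  · obtain ⟨B, hB⟩ := h2 I
    refine ⟨max B 0, ?_⟩
    rintro _ ⟨p, hp, q, hq, hpq, rfl⟩
    by_cases h : p.1 = q.1
    · simp [spDerivW, h]
    · refine le_max_of_le_left (le_trans ?_ (hB ⟨p.1, hp.1, q.1, hq.1, h, rfl⟩))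
      have : 0 < ‖p.1 - q.1‖ := norm_pos_iff.2 (sub_ne_zero.2 h)
      unfold spDerivW
      gcongr
      exact le_add_of_nonneg_right (by positivity)
  · rw [ht]
    refine ⟨0, ?_⟩
    rintro _ ⟨p, hp, q, hq, hpq, rfl⟩
    simp

theorem norm_sub_le_parSemi_mul (hα : 0 < α) {w : Vec n → ℝ → Vec l}
    (hw : BddAbove (holQuot r α (D ×ˢ J) w)) {x : Vec n} (hx : x ∈ D) {s t : ℝ} (hs : s ∈ J)
    (ht : t ∈ J) : ‖w x t - w x s‖ ≤ parSemi r α (D ×ˢ J) w * |t - s| ^ (α / r) := by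
  rcases eq_or_ne t s with rfl | hts
  · have := parSemi_nonneg (r := r) (α := α) (D ×ˢ J) w
    simp only [sub_self, norm_zero]
    positivity
  · have h1 : 0 < |t - s| := abs_pos.2 (sub_ne_zero.2 hts)
    have h2 := le_csSup hw ⟨(x, t), ⟨hx, ht⟩, (x, s), ⟨hx, hs⟩, by simpa using hts, rfl⟩
    simp only [sub_self, norm_zero, Real.zero_rpow hα.ne', zero_add] at h2
    exact (div_le_iff₀ (by positivity)).1 h2

/-- Elements of the parabolic Hölder space which vanish at time zero have small jets for
short times. -/
theorem exists_norm_iteratedFDerivWithin_le_parNorm (hr : 2 ≤ r) (hα0 : 0 < α) (hα1 : α < 1)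
    (x₀ : Vec n) {ρ : ℝ} (hρ : 0 < ρ) :
    ∃ K : ℝ, 0 ≤ K ∧ ∀ δ : ℝ, 0 < δ → δ ≤ 1 → ∀ w : Vec n → ℝ → Vec l,
      MemPar r α (Metric.closedBall x₀ ρ) (Set.Icc 0 δ) w →
      (∀ x ∈ Metric.closedBall x₀ ρ, w x 0 = 0) →
      ∀ k ≤ r, ∀ x ∈ Metric.closedBall x₀ ρ, ∀ t ∈ Set.Icc (0 : ℝ) δ,
        ‖iteratedFDerivWithin ℝ k (fun y => w y t) (Metric.closedBall x₀ ρ) x‖ ≤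
          K * (δ ^ (α / r) * parNorm r α (Metric.closedBall x₀ ρ) (Set.Icc 0 δ) w) := by
  obtain ⟨K, hK0, hK⟩ := exists_norm_iteratedFDerivWithin_le (G := Vec l) x₀ hρ r
  refine ⟨K * 2, by positivity, fun δ hδ0 hδ1 w hw hw0 k hk x hx t ht => ?_⟩
  set D := Metric.closedBall x₀ ρ with hD
  set P := parNorm r α D (Set.Icc 0 δ) w with hP
  have hP0 : 0 ≤ P := parNorm_nonneg
  have hr0 : (0 : ℝ) < r := by positivity
  have hexp : 0 < α / r := by positivity
  have hexp1 : α / r ≤ 1 := by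
    rw [div_le_one hr0]
    have : (2 : ℝ) ≤ r := by exact_mod_cast hr
    linarith
  have h0J : (0 : ℝ) ∈ Set.Icc 0 δ := ⟨le_rfl, hδ0.le⟩
  obtain ⟨-, w2, w3, -, w5, w6, -⟩ := hw
  have htδ : t ≤ δ ^ (α / r) := by
    refine ht.2.trans ?_
    simpa using Real.rpow_le_rpow_of_exponent_ge hδ0 hδ1 hexp1
  have hA : ∀ y ∈ D, ‖w y t‖ ≤ δ ^ (α / r) * P := by
    intro y hy
    have hbdd : BddAbove {c | ∃ p ∈ D ×ˢ Set.Icc 0 δ, c = ‖tDerivW (Set.Icc 0 δ) w p.1 p.2‖} := by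
      refine (((isCompact_closedBall x₀ ρ).prod isCompact_Icc).bddAbove_image w5.norm).mono ?_
      rintro _ ⟨p, hp, rfl⟩
      exact ⟨p, hp, rfl⟩
    have h1 := (convex_Icc (0 : ℝ) δ).norm_image_sub_le_of_norm_derivWithin_le
      (f := fun s => w y s) (C := P) (w3 y hy)
      (fun s hs => (le_csSup hbdd ⟨(y, s), ⟨hy, hs⟩, rfl⟩).trans supQ_tDerivW_le_parNorm)
      h0J ht
    simp only [hw0 y hy, sub_zero, Real.norm_of_nonneg ht.1] at h1
    rw [mul_comm]
    exact h1.trans (by gcongr)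
  have hB : ∀ y ∈ D, ‖iteratedFDerivWithin ℝ r (fun y => w y t) D y‖ ≤ δ ^ (α / r) * P := by
    intro y hy
    refine (norm_le_sum_norm_apply_single _).trans ?_
    calc _ ≤ ∑ I : Fin r → Fin n,
          δ ^ (α / r) * parSemi r α (D ×ˢ Set.Icc 0 δ) (spDerivW D r I w) := by
          refine Finset.sum_le_sum fun I _ => ?_
          have h1 := norm_sub_le_parSemi_mul hα0 (w6 I) hy h0J ht
          have h2 : spDerivW D r I w y 0 = 0 := by
            unfold spDerivW pderivW
            rw [iteratedFDerivWithin_congr (f := fun _ => (0 : Vec l)) hw0 hy]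
            simp
          rw [h2, sub_zero, sub_zero, abs_of_nonneg ht.1, mul_comm] at h1
          refine h1.trans (mul_le_mul_of_nonneg_right ?_ (parSemi_nonneg _ _))
          exact Real.rpow_le_rpow ht.1 ht.2 hexp.le
      _ ≤ δ ^ (α / r) * P := by
          rw [← Finset.mul_sum]
          gcongr
          exact sum_parSemi_le_parNorm
  refine (hK (fun y => w y t) (w2 t ht) _ _ hA hB k hk x hx).trans_eq ?_
  ring

end ParabolicSpaces

section PartialRemainder

variable {A B C E : Type*} [NormedAddCommGroup A] [NormedSpace ℝ A] [NormedAddCommGroup B]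
  [NormedSpace ℝ B] [NormedAddCommGroup C] [NormedSpace ℝ C] [NormedAddCommGroup E]
  [NormedSpace ℝ E]

theorem exists_lipschitz_fderivWithin {S : Set A} (hSc : IsCompact S) (hS : Convex ℝ S)
    (hSu : UniqueDiffOn ℝ S) {g : A → E} (hg : ContDiffOn ℝ 2 g S) :
    ∃ L : ℝ, ∀ p ∈ S, ∀ q ∈ S,
      ‖fderivWithin ℝ g S q - fderivWithin ℝ g S p‖ ≤ L * ‖q - p‖ := by
  have h1 : ContDiffOn ℝ 1 (fderivWithin ℝ g S) S := hg.fderivWithin hSu (by norm_num)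
  obtain ⟨L, hL⟩ := hSc.exists_bound_of_continuousOn (h1.continuousOn_fderivWithin hSu le_rfl)
  exact ⟨L, fun p hp q hq => hS.norm_image_sub_le_of_norm_fderivWithin_le
    (h1.differentiableOn one_ne_zero) hL hp hq⟩

/-- Second-order remainder estimate for a function of three variables, linearised in the last
one at a nearby point. -/
theorem exists_norm_partial_remainder_le {S : Set A} {T : Set B} {Z : Set C} (hSc : IsCompact S)
    (hTc : IsCompact T) (hZc : IsCompact Z) (hS : Convex ℝ S) (hT : Convex ℝ T)
    (hZ : Convex ℝ Z) (hSu : UniqueDiffOn ℝ S) (hTu : UniqueDiffOn ℝ T) (hZu : UniqueDiffOn ℝ Z)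
    {F : A → B → C → E}
    (hF : ContDiffOn ℝ 2 (fun q : A × B × C => F q.1 q.2.1 q.2.2) (S ×ˢ T ×ˢ Z)) :
    ∃ L : ℝ, 0 ≤ L ∧ ∀ x ∈ S, ∀ t ∈ T, ∀ s ∈ T, ∀ z₀ ∈ Z, ∀ z₁ ∈ Z, ∀ z₂ ∈ Z, ∀ ε : ℝ,
      ‖t - s‖ ≤ ε → ‖z₁ - z₀‖ ≤ ε → ‖z₂ - z₀‖ ≤ ε →
      ‖F x t z₁ - F x t z₂ - fderivWithin ℝ (F x s) Z z₀ (z₁ - z₂)‖ ≤ L * ε * ‖z₁ - z₂‖ := by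
  set Q := S ×ˢ T ×ˢ Z with hQ
  set g : A × B × C → E := fun q => F q.1 q.2.1 q.2.2 with hg
  obtain ⟨L, hL⟩ := exists_lipschitz_fderivWithin (hSc.prod (hTc.prod hZc))
    (hS.prod (hT.prod hZ)) (hSu.prod (hTu.prod hZu)) hF
  let ι : C →L[ℝ] A × B × C :=
    (0 : C →L[ℝ] A).prod ((0 : C →L[ℝ] B).prod (ContinuousLinearMap.id ℝ C))
  have hder : ∀ x ∈ S, ∀ t ∈ T, ∀ z ∈ Z,
      HasFDerivWithinAt (F x t) ((fderivWithin ℝ g Q (x, t, z)).comp ι) Z z := by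
    intro x hx t ht z hz
    have h1 : HasFDerivWithinAt g (fderivWithin ℝ g Q (x, t, z)) Q (x, t, z) :=
      ((hF.differentiableOn two_ne_zero) (x, t, z) ⟨hx, ht, hz⟩).hasFDerivWithinAt
    have h2 : HasFDerivWithinAt (fun z' => (x, t, z')) ι Z z :=
      (hasFDerivWithinAt_const x z Z).prodMk
        ((hasFDerivWithinAt_const t z Z).prodMk (hasFDerivWithinAt_id z Z))
    exact h1.comp (t := Q) z h2 fun z' hz' => ⟨hx, ht, hz'⟩
  refine ⟨|L| * ‖ι‖, by positivity, fun x hx t ht s hs z₀ hz₀ z₁ hz₁ z₂ hz₂ ε hts h₁ h₂ => ?_⟩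
  rw [(hder x hx s hs z₀ hz₀).fderivWithin (hZu z₀ hz₀)]
  refine (hZ.inter (convex_closedBall z₀ ε)).norm_image_sub_le_of_norm_hasFDerivWithin_le'
    (fun z hz => (hder x hx t ht z hz.1).mono Set.inter_subset_left) (fun z hz => ?_)
    ⟨hz₂, by rwa [Metric.mem_closedBall, dist_eq_norm]⟩
    ⟨hz₁, by rwa [Metric.mem_closedBall, dist_eq_norm]⟩
  have hzε : ‖z - z₀‖ ≤ ε := by
    rw [← dist_eq_norm]
    exact hz.2
  have h3 : ‖(x, t, z) - (x, s, z₀)‖ ≤ ε := by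
    rw [Prod.mk_sub_mk, Prod.mk_sub_mk, sub_self]
    exact max_le (by simpa using (norm_nonneg _).trans hts) (max_le hts hzε)
  rw [← ContinuousLinearMap.sub_comp]
  calc _ ≤ ‖fderivWithin ℝ g Q (x, t, z) - fderivWithin ℝ g Q (x, s, z₀)‖ * ‖ι‖ :=
        ContinuousLinearMap.opNorm_comp_le _ _
    _ ≤ (|L| * ε) * ‖ι‖ := by
        gcongr
        refine (hL _ ⟨hx, hs, hz₀⟩ _ ⟨hx, ht, hz.1⟩).trans ?_
        gcongr
        exact le_abs_self L
    _ = |L| * ‖ι‖ * ε := by ring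

end PartialRemainder

/-- **Supremum bound for the remainder `η`** (from the proof of Theorem 1.2): `|η|_{0;Q} ≤ C(R) δ^{2α/r} ‖u − v‖_{C^{r+α,1+α/r}}`, with `C(R)` independent of `δ`, `u`, `v`. -/
theorem sup_bound_eta
    (n l r : ℕ) (hn : 1 ≤ n) (hl : 1 ≤ l) (hr : 2 ≤ r) (hrev : Even r)
    (α : ℝ) (hα0 : 0 < α) (hα1 : α < 1)
    (x₀ : Vec n) (Rad : ℝ) (hRad : 0 < Rad)
    (R₀ R : ℝ) (hR₀ : 0 < R₀) (hR : 0 < R)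
    (u₀ : Vec n → Vec l) (hu₀ : MemSp r α (closure (Metric.ball x₀ Rad)) u₀)
    (Z : Set (Jet n l r)) (hZcomp : IsCompact Z) (hZconv : Convex ℝ Z)
    (hZnbhd : ∀ x ∈ closure (Metric.ball x₀ Rad),
      Metric.closedBall (jetOf (closure (Metric.ball x₀ Rad)) r u₀ x) R₀ ⊆ Z)
    (F : Vec n → ℝ → Jet n l r → Vec l)
    (hF : ContDiffOn ℝ 2 (fun q : Vec n × ℝ × Jet n l r => F q.1 q.2.1 q.2.2)
      (closure (Metric.ball x₀ Rad) ×ˢ Set.Icc (0 : ℝ) 1 ×ˢ Z)) :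
    ∃ C : ℝ, 0 < C ∧
      ∀ δ : ℝ, 0 < δ → δ ≤ 1 →
        ∀ u v : Vec n → ℝ → Vec l,
          MemPar r α (closure (Metric.ball x₀ Rad)) (Set.Icc 0 δ) u →
          (∀ x ∈ closure (Metric.ball x₀ Rad), u x 0 = u₀ x) →
          parNorm r α (closure (Metric.ball x₀ Rad)) (Set.Icc 0 δ)
            (fun x t => u x t - u₀ x) ≤ R →
          (∀ x ∈ closure (Metric.ball x₀ Rad), ∀ t ∈ Set.Icc (0 : ℝ) δ,
            jetOf (closure (Metric.ball x₀ Rad)) r (fun y => u y t) x ∈ Z) →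
          MemPar r α (closure (Metric.ball x₀ Rad)) (Set.Icc 0 δ) v →
          (∀ x ∈ closure (Metric.ball x₀ Rad), v x 0 = u₀ x) →
          parNorm r α (closure (Metric.ball x₀ Rad)) (Set.Icc 0 δ)
            (fun x t => v x t - u₀ x) ≤ R →
          (∀ x ∈ closure (Metric.ball x₀ Rad), ∀ t ∈ Set.Icc (0 : ℝ) δ,
            jetOf (closure (Metric.ball x₀ Rad)) r (fun y => v y t) x ∈ Z) →
          supQ (closure (Metric.ball x₀ Rad) ×ˢ Set.Icc 0 δ)
            (fun x t =>
              F x t (jetOf (closure (Metric.ball x₀ Rad)) r (fun y => u y t) x)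
                - F x t (jetOf (closure (Metric.ball x₀ Rad)) r (fun y => v y t) x)
                - ∑ k ∈ Finset.range (r + 1), ∑ I : Fin k → Fin n, ∑ b : Fin l,
                    spDerivW (closure (Metric.ball x₀ Rad)) k I
                        (fun y s => u y s - v y s) x t b •
                      fderivWithin ℝ (fun z => F x 0 z) Z
                        (jetOf (closure (Metric.ball x₀ Rad)) r u₀ x) (jetBasisG r k I b))
            ≤ C * δ ^ (2 * α / r) *
                parNorm r α (closure (Metric.ball x₀ Rad)) (Set.Icc 0 δ)
                  (fun x t => u x t - v x t) := by
  rw [closure_ball x₀ hRad.ne'] at *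
  set D := Metric.closedBall x₀ Rad with hDdef
  have hDu : UniqueDiffOn ℝ D := uniqueDiffOn_closedBall x₀ hRad
  have hx₀ : x₀ ∈ D := Metric.mem_closedBall_self hRad.le
  have hZu : UniqueDiffOn ℝ Z := uniqueDiffOn_convex hZconv
    ⟨jetOf D r u₀ x₀, interior_mono (hZnbhd x₀ hx₀)
      (Metric.ball_subset_interior_closedBall (Metric.mem_ball_self hR₀))⟩
  obtain ⟨K, hK0, hK⟩ :=
    exists_norm_iteratedFDerivWithin_le_parNorm (l := l) hr hα0 hα1 x₀ hRad
  obtain ⟨L, hL0, hL⟩ := exists_norm_partial_remainder_le (isCompact_closedBall x₀ Rad)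
    isCompact_Icc hZcomp (convex_closedBall x₀ Rad) (convex_Icc (0 : ℝ) 1) hZconv hDu
    (uniqueDiffOn_Icc one_pos) hZu hF
  refine ⟨L * (1 + K * R) * K + 1, by positivity, ?_⟩
  intro δ hδ0 hδ1 u v hu hu0 huR huZ hv hv0 hvR hvZ
  have hJ : UniqueDiffOn ℝ (Set.Icc 0 δ) := uniqueDiffOn_Icc hδ0
  set P := parNorm r α D (Set.Icc 0 δ) (fun x t => u x t - v x t) with hP
  have hP0 : 0 ≤ P := parNorm_nonneg
  have hE2 : δ ^ (2 * α / r) = δ ^ (α / r) * δ ^ (α / r) := by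
    rw [← Real.rpow_add hδ0]
    ring_nf
  have hE0 : 0 ≤ δ ^ (α / r) := by positivity
  have hδE : δ ≤ δ ^ (α / r) := by
    have hr0 : (0 : ℝ) < r := by positivity
    have h1 : α / r ≤ 1 := by
      rw [div_le_one hr0]
      have : (2 : ℝ) ≤ r := by exact_mod_cast hr
      linarith
    simpa using Real.rpow_le_rpow_of_exponent_ge hδ0 hδ1 h1
  have hdiff : ∀ w : Vec n → ℝ → Vec l, MemPar r α D (Set.Icc 0 δ) w →
      (∀ x ∈ D, w x 0 = u₀ x) →
      parNorm r α D (Set.Icc 0 δ) (fun x t => w x t - u₀ x) ≤ R →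
      ∀ x ∈ D, ∀ t ∈ Set.Icc (0 : ℝ) δ,
        ‖jetOf D r (fun y => w y t) x - jetOf D r u₀ x‖ ≤ (1 + K * R) * δ ^ (α / r) := by
    intro w hw hw0 hwR x hx t ht
    rw [← jetOf_sub hDu (hw.2.1 t ht) hu₀.1 hx]
    refine (norm_jetOf_le (mul_nonneg hK0 (mul_nonneg hE0 parNorm_nonneg)) fun k hk =>
      hK δ hδ0 hδ1 _ (hw.sub hDu hJ (hu₀.memPar hDu))
        (fun y hy => sub_eq_zero.2 (hw0 y hy)) k hk x hx t ht).trans ?_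
    have := mul_le_mul_of_nonneg_left (mul_le_mul_of_nonneg_left hwR hE0) hK0
    linarith
  refine Real.sSup_le ?_ (by positivity)
  rintro _ ⟨⟨x, t⟩, ⟨hx, ht⟩, rfl⟩
  dsimp only at hx ht ⊢
  set zu := jetOf D r (fun y => u y t) x with hzu
  set zv := jetOf D r (fun y => v y t) x with hzv
  set z₀ := jetOf D r u₀ x with hz₀
  have hsub : jetOf D r (fun y => u y t - v y t) x = zu - zv :=
    jetOf_sub hDu (hu.2.1 t ht) (hv.2.1 t ht) hx
  have hlin : ∑ k ∈ Finset.range (r + 1), ∑ I : Fin k → Fin n, ∑ b : Fin l,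
      spDerivW D k I (fun y s => u y s - v y s) x t b •
        fderivWithin ℝ (fun z => F x 0 z) Z z₀ (jetBasisG r k I b)
      = fderivWithin ℝ (fun z => F x 0 z) Z z₀ (zu - zv) := by
    rw [← hsub, ← sum_pderivW_smul_jetBasisG]
    simp only [map_sum, map_smul]
    rfl
  have hw : ‖zu - zv‖ ≤ K * (δ ^ (α / r) * P) := by
    rw [← hsub]
    exact norm_jetOf_le (by positivity) fun k hk =>
      hK δ hδ0 hδ1 _ (hu.sub hDu hJ hv)
        (fun y hy => sub_eq_zero.2 ((hu0 y hy).trans (hv0 y hy).symm)) k hk x hx t ht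
  have htE : ‖t - 0‖ ≤ (1 + K * R) * δ ^ (α / r) := by
    rw [sub_zero, Real.norm_of_nonneg ht.1]
    have : 0 ≤ K * R * δ ^ (α / r) := by positivity
    linarith [ht.2]
  have hmain := hL x hx t ⟨ht.1, ht.2.trans hδ1⟩ 0 ⟨le_rfl, zero_le_one⟩ z₀
    (hZnbhd x hx (Metric.mem_closedBall_self hR₀.le)) zu (huZ x hx t ht) zv (hvZ x hx t ht) _
    htE (hdiff u hu hu0 huR x hx t ht) (hdiff v hv hv0 hvR x hx t ht)
  rw [hlin]
  calc _ ≤ L * ((1 + K * R) * δ ^ (α / r)) * ‖zu - zv‖ := hmain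
    _ ≤ L * ((1 + K * R) * δ ^ (α / r)) * (K * (δ ^ (α / r) * P)) := by gcongr
    _ = L * (1 + K * R) * K * δ ^ (2 * α / r) * P := by rw [hE2]; ring
    _ ≤ (L * (1 + K * R) * K + 1) * δ ^ (2 * α / r) * P := by
        gcongr
        exact le_add_of_nonneg_right zero_le_one
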